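/- arXiv:2102.07595 — 2 statements merged into one kernel-verified Lean document; each statement's English description precedes it below -/
import Mathlib

section
/- Fix integers d ≥ 1 and m ≥ 1 and a real number a. For every ε > 0 there exists a function f in the class F_a with ∫ |f(r)| r^{d−1} dr < ε; equivalently, the infimum of ∫ |f(r)| r^{d−1} dr over f ∈ F_a equals 0. -/
/-- The class `F_a`: smooth functions `f : ℝ → ℝ` with compact support contained in `(1, ∞)`,
whose moments `∫ f(r) r^(i+d-1) dr` vanish for `0 ≤ i ≤ m-1` and whose `m`-th moment
`∫ f(r) r^(m+d-1) dr` equals `a`. -/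
def MemFa (d m : ℕ) (a : ℝ) (f : ℝ → ℝ) : Prop :=
  ContDiff ℝ (⊤ : ℕ∞) f ∧ HasCompactSupport f ∧ tsupport f ⊆ Set.Ioi (1 : ℝ) ∧
    (∀ i < m, (∫ r : ℝ, f r * r ^ (i + d - 1)) = 0) ∧
    (∫ r : ℝ, f r * r ^ (m + d - 1)) = a

/-- For every `m` there is a smooth function with compact support in `(1, ∞)` whose moments of
order less than `m` vanish and whose moment of order `m` does not. -/
theorem exists_smooth_vanishing_moments (m : ℕ) :
    ∃ ψ : ℝ → ℝ, ContDiff ℝ (⊤ : ℕ∞) ψ ∧ HasCompactSupport ψ ∧ tsupport ψ ⊆ Set.Ioi (1 : ℝ) ∧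
      (∀ i < m, (∫ r : ℝ, ψ r * r ^ i) = 0) ∧ (∫ r : ℝ, ψ r * r ^ m) ≠ 0 := by
  induction m with
  | zero =>
    let φ : ContDiffBump (3 : ℝ) := ⟨1 / 2, 1, by norm_num, by norm_num⟩
    refine ⟨φ, φ.contDiff, φ.hasCompactSupport, ?_, by simp, ?_⟩
    · rw [φ.tsupport_eq, Real.closedBall_eq_Icc]
      intro x hx
      have h := hx.1
      simp only [φ] at h
      exact Set.mem_Ioi.2 (by linarith)
    · simpa using (φ.integral_pos (μ := MeasureTheory.volume)).ne'
  | succ m ih =>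
    obtain ⟨ψ, hψ, hc, hs, h0, hm⟩ := ih
    have hψ' : ContDiff ℝ (⊤ : ℕ∞) (deriv ψ) := (contDiff_infty_iff_deriv.1 hψ).2
    have parts (i : ℕ) :
        (∫ r : ℝ, deriv ψ r * r ^ i) = -((i : ℝ) * ∫ r : ℝ, ψ r * r ^ (i - 1)) := by
      have := MeasureTheory.integral_mul_deriv_eq_deriv_mul_of_integrable
        (u := ψ) (u' := deriv ψ) (v := fun r : ℝ => r ^ i)
        (v' := fun r : ℝ => (i : ℝ) * r ^ (i - 1))
        (fun x _ => (hψ.differentiable (by simp) x).hasDerivAt)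
        (fun x _ => hasDerivAt_pow i x)
        (Continuous.integrable_of_hasCompactSupport (by have := hψ.continuous; fun_prop)
          hc.mul_right)
        (Continuous.integrable_of_hasCompactSupport (by have := hψ'.continuous; fun_prop)
          hc.deriv.mul_right)
        (Continuous.integrable_of_hasCompactSupport (by have := hψ.continuous; fun_prop)
          hc.mul_right)
      rw [← MeasureTheory.integral_const_mul, ← neg_eq_iff_eq_neg, ← this]
      exact MeasureTheory.integral_congr_ae (.of_forall fun x => by simp only; ring)
    refine ⟨deriv ψ, hψ', hc.deriv, tsupport_deriv_subset.trans hs, fun i hi => ?_, ?_⟩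
    · rw [parts]
      rcases i with _ | i
      · simp
      · simp [h0 i (by omega)]
    · rw [parts, Nat.add_sub_cancel]
      exact neg_ne_zero.2 (mul_ne_zero (by positivity) hm)

/-- The class `F_a` is nonempty. -/
theorem exists_memFa (d m : ℕ) (hd : 1 ≤ d) (a : ℝ) : ∃ f : ℝ → ℝ, MemFa d m a f := by
  obtain ⟨ψ, hψ, hc, hs, h0, hm⟩ := exists_smooth_vanishing_moments m
  set c : ℝ := a / ∫ r : ℝ, ψ r * r ^ m with hcdef
  have hsub : tsupport (fun r : ℝ => ψ r * (c / r ^ (d - 1))) ⊆ tsupport ψ :=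
    tsupport_mul_subset_left
  have moment (i : ℕ) : (∫ r : ℝ, ψ r * (c / r ^ (d - 1)) * r ^ (i + d - 1)) =
      c * ∫ r : ℝ, ψ r * r ^ i := by
    rw [← MeasureTheory.integral_const_mul]
    refine MeasureTheory.integral_congr_ae (.of_forall fun x => ?_)
    by_cases hx : ψ x = 0
    · simp [hx]
    · have h1 : (1 : ℝ) < x := hs (subset_tsupport _ hx)
      have hx0 : x ≠ 0 := by positivity
      simp only [Nat.add_sub_assoc hd, pow_add]
      field_simp
  refine ⟨fun r => ψ r * (c / r ^ (d - 1)),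
    contMDiff_iff_contDiff.1 (contMDiff_of_tsupport fun x hx => ?_),
    hc.mul_right, hsub.trans hs, fun i hi => ?_, ?_⟩
  · have h1 : (1 : ℝ) < x := hs (hsub hx)
    rw [contMDiffAt_iff_contDiffAt]
    exact hψ.contDiffAt.mul (contDiffAt_const.div (contDiffAt_id.pow _)
      (pow_ne_zero _ (by positivity)))
  · rw [moment, h0 i hi, mul_zero]
  · rw [moment, hcdef, div_mul_cancel₀ _ hm]

/-- Moments of a dilated function. -/
theorem integral_comp_div_mul_pow (g : ℝ → ℝ) {R : ℝ} (hR : 0 < R) (k : ℕ) :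
    (∫ r : ℝ, g (r / R) * r ^ k) = R ^ (k + 1) * ∫ r : ℝ, g r * r ^ k := by
  have := MeasureTheory.Measure.integral_comp_div (fun r : ℝ => g r * r ^ k) R
  rw [abs_of_pos hR, smul_eq_mul] at this
  rw [pow_succ, mul_assoc, ← this, ← MeasureTheory.integral_const_mul]
  refine MeasureTheory.integral_congr_ae (.of_forall fun x => ?_)
  simp only [div_pow]
  field_simp

/-- The class `F_a` is invariant under the dilations `g ↦ R^(-(m+d)) g(·/R)` with `R ≥ 1`. -/
theorem MemFa.dilate {d m : ℕ} {a : ℝ} {g : ℝ → ℝ} (hd : 1 ≤ d) (hg : MemFa d m a g) {R : ℝ}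
    (hR : 1 ≤ R) : MemFa d m a (fun r => (R ^ (m + d))⁻¹ * g (r / R)) := by
  obtain ⟨hsm, hc, hs, h0, hm⟩ := hg
  have hR0 : 0 < R := by positivity
  have moment (k : ℕ) : (∫ r : ℝ, (R ^ (m + d))⁻¹ * g (r / R) * r ^ k) =
      (R ^ (m + d))⁻¹ * (R ^ (k + 1) * ∫ r : ℝ, g r * r ^ k) := by
    simp only [mul_assoc, MeasureTheory.integral_const_mul, integral_comp_div_mul_pow g hR0]
  refine ⟨contDiff_const.mul (hsm.comp (contDiff_id.div_const R)),
    HasCompactSupport.mul_left (hc.comp_homeomorph (OrderIso.divRight₀ R hR0).toHomeomorph), fun x hx => ?_,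
    fun i hi => ?_, ?_⟩
  · have h1 : x / R ∈ tsupport g :=
      tsupport_comp_subset_preimage g (f := fun r : ℝ => r / R) (by fun_prop)
        (tsupport_mul_subset_right hx)
    have h2 : 1 < x / R := hs h1
    rw [lt_div_iff₀ hR0] at h2
    exact Set.mem_Ioi.2 (by linarith)
  · rw [moment, h0 i hi, mul_zero, mul_zero]
  · rw [moment, hm, Nat.sub_add_cancel (by omega), inv_mul_cancel_left₀ (by positivity)]

/-- For all `d ≥ 1`, `m ≥ 1` and `a : ℝ`, the infimum of `∫ |f(r)| r^(d-1) dr` over `f ∈ F_a`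
is `0`: for every `ε > 0` there is `f ∈ F_a` with `∫ |f(r)| r^(d-1) dr < ε`. -/
theorem exists_memFa_small_weighted_L1 (d m : ℕ) (hd : 1 ≤ d) (hm : 1 ≤ m) (a : ℝ) :
    ∀ ε : ℝ, 0 < ε → ∃ f : ℝ → ℝ, MemFa d m a f ∧
      (∫ r : ℝ, |f r| * r ^ (d - 1)) < ε := by
  intro ε hε
  obtain ⟨g, hg⟩ := exists_memFa d m hd a
  set I : ℝ := ∫ r : ℝ, |g r| * r ^ (d - 1) with hI
  set R : ℝ := max 1 (I / ε + 1)
  have hR : 1 ≤ R := le_max_left _ _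
  have hR0 : 0 < R := by positivity
  refine ⟨_, hg.dilate hd hR, ?_⟩
  have key : (∫ r : ℝ, |(R ^ (m + d))⁻¹ * g (r / R)| * r ^ (d - 1)) = I / R ^ m := by
    have hpos : 0 < (R ^ (m + d))⁻¹ := by positivity
    simp only [abs_mul, abs_of_pos hpos, mul_assoc, MeasureTheory.integral_const_mul]
    rw [integral_comp_div_mul_pow (fun r => |g r|) hR0, Nat.sub_add_cancel hd, ← hI]
    field_simp
    ring
  rw [key, div_lt_iff₀ (by positivity)]
  have h1 : I / ε < R := (lt_add_one _).trans_le (le_max_right _ _)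
  rw [div_lt_iff₀ hε] at h1
  have h2 : R ≤ R ^ m := le_self_pow₀ hR (by omega)
  nlinarith
end

section
/- For every integer d ≥ 1, every integer m ≥ 0, and all real numbers κ > 0 and β > 0, there exists a C^∞ even function K : ℝ → ℝ whose support is contained in [−1, 1] and which satisfies: (A') ∫₀^∞ K(r) r^{d−1} dr = κ; (B'(m)) ∫₀^∞ K(r) r^{d+i−1} dr = 0 for every integer 1 ≤ i ≤ m; and (C'(β)) ∫₀^∞ K₋(r) r^{d−1} dr ≤ β, where K₋(r) = max(−K(r), 0) is the negative part of K. -/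
open MeasureTheory Set

/-- A continuous function supported in `[0, 1]` has all its half-line moments. -/
theorem integrableOn_mul_pow_of_support_subset {f : ℝ → ℝ} (hf : Continuous f)
    (hs : Function.support f ⊆ Icc 0 1) (n : ℕ) :
    IntegrableOn (fun r => f r * r ^ n) (Ioi 0) := by
  have hc : HasCompactSupport f := HasCompactSupport.of_support_subset_isCompact isCompact_Icc hs
  exact ((hf.mul (continuous_pow n)).integrable_of_hasCompactSupport hc.mul_right).integrableOn

/-- A nonnegative continuous function supported in `[0, 1]` whose `n`-th half-line moment vanishes
is zero. -/
theorem eq_zero_of_moment_eq_zero {f : ℝ → ℝ} (hf : Continuous f)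
    (hs : Function.support f ⊆ Icc 0 1) (h0 : ∀ r, 0 ≤ f r) (n : ℕ)
    (hI : ∫ r in Ioi (0 : ℝ), f r * r ^ n = 0) {r : ℝ} (hr : 0 < r) : f r = 0 := by
  have hcont : Continuous fun r : ℝ => f r * r ^ n := hf.mul (continuous_pow n)
  have hae : (fun r => f r * r ^ n) =ᵐ[volume.restrict (Ioi 0)] 0 := by
    refine (setIntegral_eq_zero_iff_of_nonneg_ae ?_
      (integrableOn_mul_pow_of_support_subset hf hs n)).1 hI
    filter_upwards [ae_restrict_mem measurableSet_Ioi] with x hx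
    exact mul_nonneg (h0 x) (pow_nonneg (le_of_lt hx) n)
  have := Measure.eqOn_open_of_ae_eq hae isOpen_Ioi hcont.continuousOn continuousOn_const hr
  simpa [hr.ne'] using this

/-- A smooth bump supported in `[0, δ]`. -/
theorem exists_contDiffBump_support_subset {δ : ℝ} (hδ : 0 < δ) :
    ∃ b : ContDiffBump (δ / 2), Function.support b ⊆ Icc 0 δ := by
  refine ⟨⟨δ / 4, δ / 2, by linarith, by linarith⟩, ?_⟩
  rw [ContDiffBump.support_eq, Real.ball_eq_Ioo]
  intro x hx
  constructor <;> linarith [hx.1, hx.2]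

/-- Nonnegative smooth functions with unit `n`-th moment exist with arbitrarily small support. -/
theorem exists_nonneg_moment_eq_one {δ : ℝ} (hδ : 0 < δ) (hδ1 : δ ≤ 1) (n : ℕ) :
    ∃ φ : ℝ → ℝ, ContDiff ℝ (⊤ : ℕ∞) φ ∧ Function.support φ ⊆ Icc 0 δ ∧ (∀ r, 0 ≤ φ r) ∧
      ∫ r in Ioi (0 : ℝ), φ r * r ^ n = 1 := by
  obtain ⟨b, hb⟩ := exists_contDiffBump_support_subset hδ
  have hb1 : Function.support b ⊆ Icc 0 1 := hb.trans (Icc_subset_Icc_right hδ1)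
  set I := ∫ r in Ioi (0 : ℝ), b r * r ^ n with hI
  have hI0 : 0 ≤ I := setIntegral_nonneg measurableSet_Ioi fun x hx =>
    mul_nonneg b.nonneg (pow_nonneg (le_of_lt hx) n)
  have hne : I ≠ 0 := fun h => by
    have hz := eq_zero_of_moment_eq_zero b.continuous hb1 (fun _ => b.nonneg) n h (half_pos hδ)
    have := b.one_of_mem_closedBall (Metric.mem_closedBall_self b.rIn_pos.le)
    linarith
  refine ⟨fun r => I⁻¹ * b r, contDiff_const.mul b.contDiff, ?_,
    fun r => mul_nonneg (inv_nonneg.2 hI0) b.nonneg, ?_⟩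
  · exact (Function.support_mul_subset_right _ _).trans hb
  · simp_rw [mul_assoc]
    rw [integral_const_mul, ← hI, inv_mul_cancel₀ hne]

/-- Finitely many consecutive half-line moments of a smooth function supported in `[0, 1]` can be
prescribed arbitrarily. -/
theorem exists_contDiff_moment_eq (k n : ℕ) (v : Fin n → ℝ) :
    ∃ ψ : ℝ → ℝ, ContDiff ℝ (⊤ : ℕ∞) ψ ∧ Function.support ψ ⊆ Icc 0 1 ∧
      ∀ i : Fin n, ∫ r in Ioi (0 : ℝ), ψ r * r ^ (k + i) = v i := by
  obtain ⟨b, hb⟩ := exists_contDiffBump_support_subset one_pos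
  let P : (Fin n → ℝ) → ℝ → ℝ := fun c r => b r * ∑ j, c j * r ^ (j : ℕ)
  have hP : ∀ c, ContDiff ℝ (⊤ : ℕ∞) (P c) := fun c =>
    b.contDiff.mul (ContDiff.sum fun j _ => contDiff_const.mul (contDiff_id.pow _))
  have hPs : ∀ c, Function.support (P c) ⊆ Icc 0 1 := fun c =>
    (Function.support_mul_subset_left _ _).trans hb
  have hPi : ∀ c l, IntegrableOn (fun r => P c r * r ^ l) (Ioi 0) := fun c l =>
    integrableOn_mul_pow_of_support_subset (hP c).continuous (hPs c) l
  let L : (Fin n → ℝ) →ₗ[ℝ] (Fin n → ℝ) :=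
    { toFun := fun c i => ∫ r in Ioi (0 : ℝ), P c r * r ^ (k + i)
      map_add' := fun c c' => by
        ext i
        rw [Pi.add_apply, ← integral_add (hPi c _) (hPi c' _)]
        congr 1
        ext r
        simp only [P, Pi.add_apply, add_mul, Finset.sum_add_distrib, mul_add]
      map_smul' := fun a c => by
        ext i
        rw [RingHom.id_apply, Pi.smul_apply, smul_eq_mul, ← integral_const_mul]
        congr 1
        ext r
        simp only [P, Pi.smul_apply, smul_eq_mul, mul_assoc, ← Finset.mul_sum]
        ring }
  have hL : Function.Injective L := by
    rw [injective_iff_map_eq_zero]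
    intro c hc
    let q : Polynomial ℝ := ∑ j : Fin n, Polynomial.monomial (j : ℕ) (c j)
    have hq : ∀ r, q.eval r = ∑ j, c j * r ^ (j : ℕ) := fun r => by
      simp [q, Polynomial.eval_finsetSum]
    have hint : ∫ r in Ioi (0 : ℝ), (b r * q.eval r ^ 2) * r ^ k = 0 := by
      calc _ = ∫ r in Ioi (0 : ℝ), ∑ i : Fin n, c i * (P c r * r ^ (k + i)) := by
            congr 1
            ext r
            rw [sq, hq]
            simp only [P]
            rw [← mul_assoc, Finset.mul_sum, Finset.sum_mul]
            refine Finset.sum_congr rfl fun i _ => ?_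
            ring
        _ = ∑ i : Fin n, c i * L c i := by
            rw [integral_finsetSum _ fun i _ => (hPi c _).const_mul _]
            simp only [integral_const_mul]
            rfl
        _ = 0 := by simp [hc]
    have hzero : ∀ r : ℝ, 0 < r → b r * q.eval r ^ 2 = 0 := fun r hr =>
      eq_zero_of_moment_eq_zero (f := fun r => b r * q.eval r ^ 2)
        (b.continuous.mul (q.continuous.pow 2)) ((Function.support_mul_subset_left _ _).trans hb)
        (fun r => mul_nonneg b.nonneg (sq_nonneg _)) k hint hr
    have hq0 : q = 0 := by
      have hmin : (0 : ℝ) < min (1 / 2) b.rIn := lt_min (by norm_num) b.rIn_pos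
      refine Polynomial.eq_zero_of_infinite_isRoot q
        ((Ioo_infinite (show (1 / 2 : ℝ) < 1 / 2 + min (1 / 2) b.rIn by linarith)).mono ?_)
      intro x hx
      have hx1 := hzero x (by linarith [hx.1])
      rw [b.one_of_mem_closedBall, one_mul] at hx1
      · exact pow_eq_zero_iff two_ne_zero |>.1 hx1
      · rw [Real.closedBall_eq_Icc]
        constructor <;> linarith [hx.1, hx.2, b.rIn_pos, min_le_right (1 / 2) b.rIn]
    ext j
    have := congrArg (fun p => Polynomial.coeff p (j : ℕ)) hq0
    simpa [q, Polynomial.finsetSum_coeff, Polynomial.coeff_monomial, Fin.val_inj] using this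
  obtain ⟨c, hc⟩ := LinearMap.surjective_of_injective hL v
  exact ⟨P c, hP c, hPs c, fun i => congrFun hc i⟩

/-- A smooth function on `[0, 1]` with `k`-th moment `κ`, vanishing moments of the next `m` orders,
and small negative part. -/
theorem exists_contDiff_moment_eq_negPart_le (k m : ℕ) {κ β : ℝ} (hκ : 0 < κ) (hβ : 0 < β) :
    ∃ g : ℝ → ℝ, ContDiff ℝ (⊤ : ℕ∞) g ∧ Function.support g ⊆ Icc 0 1 ∧
      (∀ i ≤ m, ∫ r in Ioi (0 : ℝ), g r * r ^ (k + i) = if i = 0 then κ else 0) ∧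
      ∫ r in Ioi (0 : ℝ), max (-g r) 0 * r ^ k ≤ β := by
  choose ψ hψ hψs hψm using fun j : Fin (m + 1) =>
    exists_contDiff_moment_eq k (m + 1) (Pi.single j 1)
  have habs : ∀ j, IntegrableOn (fun r => |ψ j r| * r ^ k) (Ioi 0) := fun j =>
    integrableOn_mul_pow_of_support_subset (hψ j).continuous.abs
      (fun r hr => hψs j (by simpa using hr)) k
  let C := ∑ j, ∫ r in Ioi (0 : ℝ), |ψ j r| * r ^ k
  have hCj : ∀ j, 0 ≤ ∫ r in Ioi (0 : ℝ), |ψ j r| * r ^ k := fun j =>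
    setIntegral_nonneg measurableSet_Ioi fun x hx =>
      mul_nonneg (abs_nonneg _) (pow_nonneg (le_of_lt hx) k)
  have hC : 0 ≤ C := Finset.sum_nonneg fun j _ => hCj j
  obtain ⟨δ, hδ, hδ1, hδC⟩ : ∃ δ : ℝ, 0 < δ ∧ δ ≤ 1 ∧ κ * δ * C ≤ β := by
    have hpos : 0 < κ * (C + 1) := by positivity
    refine ⟨min 1 (β / (κ * (C + 1))), lt_min one_pos (div_pos hβ hpos), min_le_left _ _, ?_⟩
    have h := (le_div_iff₀ hpos).1 (min_le_right 1 (β / (κ * (C + 1))))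
    have h0 : 0 < min 1 (β / (κ * (C + 1))) := lt_min one_pos (div_pos hβ hpos)
    nlinarith [mul_pos hκ h0]
  obtain ⟨φ, hφ, hφs, hφ0, hφm⟩ := exists_nonneg_moment_eq_one hδ hδ1 k
  have hφi := integrableOn_mul_pow_of_support_subset hφ.continuous
    (hφs.trans (Icc_subset_Icc_right hδ1))
  let t : ℕ → ℝ := fun i => if i = 0 then κ else 0
  let a : ℕ → ℝ := fun i => κ * (∫ r in Ioi (0 : ℝ), φ r * r ^ (k + i)) - t i
  have ha : ∀ i, |a i| ≤ κ * δ := by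
    intro i
    rcases Nat.eq_zero_or_pos i with rfl | hi
    · simp only [a, t, add_zero, hφm, if_true, mul_one, sub_self, abs_zero]
      positivity
    · have hnn : 0 ≤ ∫ r in Ioi (0 : ℝ), φ r * r ^ (k + i) :=
        setIntegral_nonneg measurableSet_Ioi fun x hx =>
          mul_nonneg (hφ0 x) (pow_nonneg (le_of_lt hx) _)
      have hle : ∫ r in Ioi (0 : ℝ), φ r * r ^ (k + i) ≤ δ := by
        calc _ ≤ ∫ r in Ioi (0 : ℝ), δ * (φ r * r ^ k) := by
              refine setIntegral_mono_on (hφi _) ((hφi k).const_mul δ) measurableSet_Ioi ?_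
              intro x hx
              have hx0 : 0 < x := hx
              by_cases hxs : φ x = 0
              · simp [hxs]
              have hxδ : x ≤ δ := (hφs hxs).2
              have hxi : x ^ i ≤ δ :=
                (pow_le_of_le_one hx0.le (hxδ.trans hδ1) hi.ne').trans hxδ
              calc φ x * x ^ (k + i) = x ^ i * (φ x * x ^ k) := by ring
                _ ≤ δ * (φ x * x ^ k) := mul_le_mul_of_nonneg_right hxi
                    (mul_nonneg (hφ0 x) (pow_nonneg hx0.le k))
          _ = δ := by rw [integral_const_mul, hφm, mul_one]
      simp only [a, t, hi.ne', if_false, sub_zero]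
      rw [abs_of_nonneg (mul_nonneg hκ.le hnn)]
      exact mul_le_mul_of_nonneg_left hle hκ.le
  let g : ℝ → ℝ := fun r => κ * φ r - ∑ j : Fin (m + 1), a j * ψ j r
  have hg : ContDiff ℝ (⊤ : ℕ∞) g :=
    (contDiff_const.mul hφ).sub (ContDiff.sum fun j _ => contDiff_const.mul (hψ j))
  have hgs : Function.support g ⊆ Icc 0 1 := by
    intro r hr
    by_contra hr1
    have h1 : φ r = 0 := by
      by_contra h
      exact hr1 (Icc_subset_Icc_right hδ1 (hφs h))
    have h2 : ∀ j, ψ j r = 0 := fun j => by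
      by_contra h
      exact hr1 (hψs j h)
    exact hr (by simp [g, h1, h2])
  have hψi : ∀ j l, IntegrableOn (fun r => ψ j r * r ^ l) (Ioi 0) := fun j l =>
    integrableOn_mul_pow_of_support_subset (hψ j).continuous (hψs j) l
  refine ⟨g, hg, hgs, fun i hi => ?_, ?_⟩
  · have hsum : ∑ j : Fin (m + 1), a j * ∫ r in Ioi (0 : ℝ), ψ j r * r ^ (k + i) = a i := by
      have hi' : i < m + 1 := by omega
      rw [Finset.sum_eq_single (⟨i, hi'⟩ : Fin (m + 1))]
      · rw [hψm ⟨i, hi'⟩ ⟨i, hi'⟩]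
        simp
      · intro j _ hj
        rw [hψm j ⟨i, hi'⟩, Pi.single_eq_of_ne hj.symm, mul_zero]
      · simp
    calc _ = ∫ r in Ioi (0 : ℝ), (κ * (φ r * r ^ (k + i)) -
          ∑ j : Fin (m + 1), a j * (ψ j r * r ^ (k + i))) := by
          congr 1
          ext r
          simp only [g, sub_mul, Finset.sum_mul, mul_assoc]
      _ = t i := by
          rw [integral_sub ((hφi _).const_mul κ)
            (integrable_finsetSum _ fun j _ => (hψi j _).const_mul _),
            integral_finsetSum _ fun j _ => (hψi j _).const_mul _]
          simp only [integral_const_mul]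
          rw [hsum]
          simp only [a]
          ring
  · have hneg : IntegrableOn (fun r => max (-g r) 0 * r ^ k) (Ioi 0) := by
      refine integrableOn_mul_pow_of_support_subset (hg.continuous.neg.max continuous_const)
        (fun r hr => hgs fun h => hr ?_) k
      simp [h]
    calc _ ≤ ∫ r in Ioi (0 : ℝ), ∑ j : Fin (m + 1), κ * δ * (|ψ j r| * r ^ k) := by
          refine setIntegral_mono_on hneg
            (integrable_finsetSum _ fun j _ => (habs j).const_mul _) measurableSet_Ioi ?_
          intro x hx
          have hx0 : (0 : ℝ) ≤ x ^ k := pow_nonneg (le_of_lt hx) k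
          simp only [← mul_assoc, ← Finset.sum_mul]
          refine mul_le_mul_of_nonneg_right (max_le ?_ ?_) hx0
          · have h1 : ∑ j : Fin (m + 1), a j * ψ j x ≤ ∑ j : Fin (m + 1), κ * δ * |ψ j x| := by
              refine Finset.sum_le_sum fun j _ => ?_
              calc a j * ψ j x ≤ |a j| * |ψ j x| := by
                    rw [← abs_mul]
                    exact le_abs_self _
                _ ≤ _ := mul_le_mul_of_nonneg_right (ha j) (abs_nonneg _)
            have h2 := mul_nonneg hκ.le (hφ0 x)
            simp only [g]
            linarith
          · exact Finset.sum_nonneg fun j _ => by positivity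
      _ = κ * δ * C := by
          rw [integral_finsetSum _ fun j _ => (habs j).const_mul _]
          simp only [integral_const_mul, C, Finset.mul_sum]
      _ ≤ β := hδC


/-- **Existence of one-dimensional kernel profiles.** For every `d ≥ 1`, `m ≥ 0`, `κ > 0` and
`β > 0`, there exists a smooth even function `K : ℝ → ℝ` supported in `[-1, 1]` such that
`∫₀^∞ K(r) r^(d-1) dr = κ` (condition A'), `∫₀^∞ K(r) r^(d+i-1) dr = 0` for `1 ≤ i ≤ m`
(condition B'(m)), and the negative part satisfies `∫₀^∞ K₋(r) r^(d-1) dr ≤ β`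
(condition C'(β)). -/
theorem exists_even_kernel_profile (d : ℕ) (hd : 1 ≤ d) (m : ℕ) (κ β : ℝ)
    (hκ : 0 < κ) (hβ : 0 < β) :
    ∃ K : ℝ → ℝ,
      ContDiff ℝ (⊤ : ℕ∞) K ∧
      (∀ r : ℝ, K (-r) = K r) ∧
      tsupport K ⊆ Set.Icc (-1 : ℝ) 1 ∧
      (∫ r in Set.Ioi (0 : ℝ), K r * r ^ (d - 1)) = κ ∧
      (∀ i : ℕ, 1 ≤ i → i ≤ m → (∫ r in Set.Ioi (0 : ℝ), K r * r ^ (d + i - 1)) = 0) ∧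
      (∫ r in Set.Ioi (0 : ℝ), max (-K r) 0 * r ^ (d - 1)) ≤ β := by
  obtain ⟨g, hg, hgs, hgm, hgn⟩ := exists_contDiff_moment_eq_negPart_le (d - 1) m hκ hβ
  have hK : ∀ r ∈ Ioi (0 : ℝ), g r + g (-r) = g r := fun r hr => by
    have : g (-r) = 0 := by
      by_contra h
      have h0 := (hgs h).1
      have hr0 : (0 : ℝ) < r := hr
      linarith
    rw [this, add_zero]
  have hmom : ∀ l : ℕ, ∫ r in Ioi (0 : ℝ), (g r + g (-r)) * r ^ l =
      ∫ r in Ioi (0 : ℝ), g r * r ^ l := fun l =>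
    setIntegral_congr_fun measurableSet_Ioi fun r hr => by simp only [hK r hr]
  refine ⟨fun r => g r + g (-r), hg.add (hg.comp contDiff_neg), fun r => ?_, ?_, ?_, ?_, ?_⟩
  · simp only [neg_neg, add_comm]
  · refine closure_minimal (fun r hr => ?_) isClosed_Icc
    by_contra hr1
    have h : ∀ x : ℝ, x = r ∨ x = -r → g x = 0 := fun x hx => by
      by_contra h
      obtain ⟨h0, h1⟩ := hgs h
      rcases hx with rfl | rfl
      · exact hr1 ⟨by linarith, h1⟩
      · exact hr1 ⟨by linarith, by linarith⟩
    exact hr (by simp only [h r (Or.inl rfl), h (-r) (Or.inr rfl), add_zero])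
  · rw [hmom]
    simpa using hgm 0 (Nat.zero_le m)
  · intro i hi him
    rw [hmom, show d + i - 1 = d - 1 + i by omega, hgm i him, if_neg (by omega)]
  · refine le_of_eq_of_le (setIntegral_congr_fun measurableSet_Ioi fun r hr => ?_) hgn
    simp only [hK r hr]
end
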